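/- For every primitive set $A$ of natural numbers not containing $1$ and every set $\mathcal{Q}$ of primes, one has $f(A(\mathcal{Q})) \leq f(\mathcal{Q})$, i.e. $\sum_{n \in A(\mathcal{Q})} \frac{1}{n \log n} \leq \sum_{p \in \mathcal{Q}} \frac{1}{p \log p}$. -/

import Mathlib

/-- A set of natural numbers is primitive if no element divides another distinct element. -/
def Primitive (A : Set ℕ) : Prop := ∀ a ∈ A, ∀ b ∈ A, a ≠ b → ¬ a ∣ b

/-- The members of `A` all of whose prime factors lie in `Q`. -/
def restrictPrimes (A : Set ℕ) (Q : Set ℕ) : Set ℕ :=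
  {n | n ∈ A ∧ ∀ p : ℕ, p.Prime → p ∣ n → p ∈ Q}

/-- `f(A) = ∑_{a ∈ A} 1/(a log a)`. -/
noncomputable def fSet (A : Set ℕ) : ℝ :=
  ∑' a : A, 1 / (((a : ℕ) : ℝ) * Real.log ((a : ℕ) : ℝ))

lemma LSeries.term_ofReal_eq (g : ℕ → ℝ) {s : ℝ} (hs : s ≠ 0) (n : ℕ) :
    LSeries.term (fun n ↦ (g n : ℂ)) s n = ((g n * (n : ℝ) ^ (-s) : ℝ) : ℂ) := by
  rcases eq_or_ne n 0 with rfl | hn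
  · simp [Real.zero_rpow (neg_ne_zero.2 hs)]
  · rw [LSeries.term_of_ne_zero hn, Real.rpow_neg (Nat.cast_nonneg n), div_eq_mul_inv]
    push_cast
    rw [Complex.ofReal_cpow (Nat.cast_nonneg n)]
    simp

lemma rpow_neg_three_five_le {s : ℝ} (hs : 1 < s) :
    Real.log 3 * (3 : ℝ) ^ (-s) + Real.log 5 * (5 : ℝ) ^ (-s) ≤
      Real.log 2 * (2 : ℝ) ^ (-s) + Real.log 4 * (4 : ℝ) ^ (-s) := by
  obtain ⟨t, ht, rfl⟩ : ∃ t : ℝ, 0 < t ∧ s = t + 1 := ⟨s - 1, by linarith, by ring⟩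
  have key : ∀ x : ℝ, 0 < x → x ^ (-(t + 1)) = x ^ (-t) / x := fun x hx ↦ by
    rw [neg_add, Real.rpow_add hx, Real.rpow_neg_one]; rfl
  rw [key 2 (by norm_num), key 3 (by norm_num), key 4 (by norm_num), key 5 (by norm_num)]
  have h4 : (4 : ℝ) ^ (-t) = ((2 : ℝ) ^ (-t)) ^ 2 := by
    rw [Real.rpow_pow_comm (by norm_num)]
    norm_num
  have l4 : Real.log 4 = 2 * Real.log 2 := by
    rw [show (4 : ℝ) = 2 ^ 2 by norm_num, Real.log_pow]; norm_num
  have h53 : (5 : ℝ) ^ (-t) ≤ 3 ^ (-t) :=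
    Real.rpow_le_rpow_of_nonpos (by norm_num) (by norm_num) (by linarith)
  have h9 : ((3 : ℝ) ^ (-t)) ^ 2 ≤ ((2 : ℝ) ^ (-t)) ^ 3 := by
    rw [Real.rpow_pow_comm (by norm_num), Real.rpow_pow_comm (by norm_num)]
    exact Real.rpow_le_rpow_of_nonpos (by norm_num) (by norm_num) (by linarith)
  have hl : 5 * Real.log 3 + 3 * Real.log 5 ≤ 15 * Real.log 2 := by
    have := Real.log_le_log (x := 3 ^ 5 * 5 ^ 3) (y := 2 ^ 15) (by norm_num) (by norm_num)
    rw [Real.log_mul (by norm_num) (by norm_num)] at this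
    simp only [Real.log_pow] at this
    norm_num at this
    linarith
  rw [h4, l4]
  have p2 : (0 : ℝ) < 2 ^ (-t) := by positivity
  have p3 : (0 : ℝ) < 3 ^ (-t) := by positivity
  generalize (2 : ℝ) ^ (-t) = a at *
  generalize (3 : ℝ) ^ (-t) = b at *
  generalize (5 : ℝ) ^ (-t) = c at *
  have hb : 2 * b ≤ a + a ^ 2 := by
    refine le_of_sq_le_sq ?_ (by positivity)
    nlinarith [mul_nonneg (sq_nonneg a) (sq_nonneg (a - 1))]
  have l2 : 0 < Real.log 2 := Real.log_pos (by norm_num)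
  have l5 : 0 < Real.log 5 := Real.log_pos (by norm_num)
  nlinarith [mul_le_mul_of_nonneg_left h53 l5.le, mul_le_mul_of_nonneg_left hb l2.le,
    mul_le_mul_of_nonneg_right hl p3.le]

lemma tsum_log_mul_rpow_odd_le_even {s : ℝ} (hs : 1 < s)
    (hsum : Summable fun n : ℕ ↦ Real.log n * (n : ℝ) ^ (-s)) :
    ∑' k : ℕ, Real.log ((2 * k + 1 : ℕ) : ℝ) * ((2 * k + 1 : ℕ) : ℝ) ^ (-s) ≤
      ∑' k : ℕ, Real.log ((2 * k : ℕ) : ℝ) * ((2 * k : ℕ) : ℝ) ^ (-s) := by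
  have he := hsum.comp_injective (i := fun k : ℕ ↦ 2 * k) (fun a b h ↦ by simpa using h)
  have ho := hsum.comp_injective (i := fun k : ℕ ↦ 2 * k + 1) (fun a b h ↦ by simpa using h)
  simp only [Function.comp_def] at he ho
  rw [← he.sum_add_tsum_nat_add 3, ← ho.sum_add_tsum_nat_add 3]
  refine add_le_add ?_ (Summable.tsum_le_tsum (fun k ↦ ?_)
    ((summable_nat_add_iff 3).2 ho) ((summable_nat_add_iff 3).2 he))
  · simp only [Finset.sum_range_succ, Finset.sum_range_zero]
    have := rpow_neg_three_five_le hs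
    norm_num
    linarith
  · have anti := Real.log_div_self_rpow_antitoneOn (a := s) (by linarith)
    have hexp : ∀ x : ℝ, 6 ≤ x → Real.exp s⁻¹ ≤ x := fun x hx ↦ by
      have h1 : Real.exp s⁻¹ ≤ Real.exp 1 := Real.exp_le_exp.2 (inv_le_one_of_one_le₀ hs.le)
      linarith [Real.exp_one_lt_d9]
    have hk : (0 : ℝ) ≤ k := Nat.cast_nonneg k
    have := anti (hexp ((2 * (k + 3) : ℕ) : ℝ) (by push_cast; linarith))
      (hexp ((2 * (k + 3) + 1 : ℕ) : ℝ) (by push_cast; linarith)) (by push_cast; linarith)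
    simpa only [div_eq_mul_inv, ← Real.rpow_neg (Nat.cast_nonneg _)] using this

open ArithmeticFunction LSeries.notation in
lemma summable_vonMangoldt_mul_rpow {s : ℝ} (hs : 1 < s) :
    Summable fun n : ℕ ↦ vonMangoldt n * (n : ℝ) ^ (-s) := by
  have h := LSeriesSummable_vonMangoldt (s := (s : ℂ)) (by simpa using hs)
  unfold LSeriesSummable at h
  rw [← Complex.summable_ofReal]
  exact h.congr fun n ↦ LSeries.term_ofReal_eq (fun n ↦ vonMangoldt n) (by linarith) n

open ArithmeticFunction LSeries.notation in
lemma hasSum_log_mul_rpow {s : ℝ} (hs : 1 < s) :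
    HasSum (fun n : ℕ ↦ Real.log n * (n : ℝ) ^ (-s))
      ((∑' n : ℕ, vonMangoldt n * (n : ℝ) ^ (-s)) * ∑' n : ℕ, (n : ℝ) ^ (-s)) := by
  have hs0 : s ≠ 0 := by linarith
  have hΛ := LSeriesSummable_vonMangoldt (s := (s : ℂ)) (by simpa using hs)
  have h1 : LSeriesSummable 1 (s : ℂ) := LSeriesSummable_one_iff.2 (by simpa using hs)
  have hc := hΛ.convolution h1
  have hL := LSeries_convolution' hΛ h1
  rw [convolution_vonMangoldt_const_one] at hc hL
  have e : ∀ n : ℕ, LSeries.term (↗Complex.log) s n =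
      ((Real.log n * (n : ℝ) ^ (-s) : ℝ) : ℂ) := fun n ↦ by
    rw [← LSeries.term_ofReal_eq (fun n ↦ Real.log n) hs0]
    simp [LSeries.term_def, Complex.natCast_log]
  have e1 : ∀ n : ℕ, LSeries.term 1 s n = (((n : ℝ) ^ (-s) : ℝ) : ℂ) := fun n ↦ by
    have := LSeries.term_ofReal_eq (fun _ ↦ 1) hs0 n
    simp only [one_mul] at this
    rw [← this]
    simp [LSeries.term_def]
  have := hc.hasSum
  rw [← Complex.hasSum_ofReal, Complex.ofReal_mul, Complex.ofReal_tsum, Complex.ofReal_tsum]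
  convert this using 1
  · funext n; rw [e]
  · change _ = LSeries _ _
    rw [hL]
    unfold LSeries
    simp only [LSeries.term_ofReal_eq _ hs0, e1]

/-- The Dirichlet eta function is increasing on the half-line right of one, stated as a bound for the
Dirichlet series of the von Mangoldt function. -/
lemma tsum_vonMangoldt_mul_rpow_le {t : ℝ} (ht : 0 < t) :
    (∑' n : ℕ, ArithmeticFunction.vonMangoldt n * (n : ℝ) ^ (-(1 + t))) * (2 ^ t - 1) ≤
      Real.log 2 := by
  have hs : 1 < 1 + t := by linarith
  have hG := hasSum_log_mul_rpow hs
  generalize ∑' n : ℕ, ArithmeticFunction.vonMangoldt n * (n : ℝ) ^ (-(1 + t)) = D at hG ⊢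
  obtain ⟨Z, hZ⟩ : ∃ Z, Z = ∑' n : ℕ, (n : ℝ) ^ (-(1 + t)) := ⟨_, rfl⟩
  rw [← hZ] at hG
  have sZ : Summable fun n : ℕ ↦ (n : ℝ) ^ (-(1 + t)) :=
    Real.summable_nat_rpow.2 (by linarith)
  have Zpos : 0 < Z :=
    hZ ▸ sZ.tsum_pos (fun n ↦ by positivity) 1 (by simp)
  have he := hG.summable.comp_injective (i := fun k : ℕ ↦ 2 * k) (fun a b h ↦ by simpa using h)
  have ho := hG.summable.comp_injective (i := fun k : ℕ ↦ 2 * k + 1)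
    (fun a b h ↦ by simpa using h)
  have split := tsum_even_add_odd (f := fun n : ℕ ↦ Real.log n * (n : ℝ) ^ (-(1 + t))) he ho
  rw [hG.tsum_eq] at split
  have hle := tsum_log_mul_rpow_odd_le_even hs hG.summable
  have even : ∑' k : ℕ, Real.log ((2 * k : ℕ) : ℝ) * ((2 * k : ℕ) : ℝ) ^ (-(1 + t)) =
      2 ^ (-(1 + t)) * (Real.log 2 * Z + D * Z) := by
    rw [← hG.tsum_eq, hZ, ← tsum_mul_left, ← Summable.tsum_add (sZ.mul_left _) hG.summable,
      ← tsum_mul_left]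
    refine tsum_congr fun k ↦ ?_
    rcases eq_or_ne k 0 with rfl | hk
    · have h0 : (0 : ℝ) ^ (-(1 + t)) = 0 := Real.zero_rpow (by linarith)
      simp only [mul_zero, Nat.cast_zero, Real.log_zero, h0, add_zero]
    · have : (k : ℝ) ≠ 0 := by exact_mod_cast hk
      push_cast
      rw [Real.log_mul (by norm_num) this, Real.mul_rpow (by norm_num) (by positivity)]
      ring
  rw [even] at split hle
  have h2 : (2 : ℝ) ^ (-(1 + t)) = 1 / (2 * 2 ^ t) := by
    rw [Real.rpow_neg (by norm_num), Real.rpow_add (by norm_num), Real.rpow_one, one_div]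
  rw [h2] at split hle
  have h2t : (0 : ℝ) < 2 ^ t := by positivity
  have main : D * Z ≤ 2 * (1 / (2 * 2 ^ t) * (Real.log 2 * Z + D * Z)) := by linarith
  have e : 2 * (1 / (2 * 2 ^ t) * (Real.log 2 * Z + D * Z)) =
      (Real.log 2 + D) * Z / 2 ^ t := by field_simp
  rw [e, le_div_iff₀ h2t] at main
  refine le_of_mul_le_mul_right ?_ Zpos
  linarith

lemma mul_tsum_vonMangoldt_le {t : ℝ} (ht : 0 < t) :
    t * ∑' n : ℕ, ArithmeticFunction.vonMangoldt n * (n : ℝ) ^ (-(1 + t)) ≤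
      Real.exp (-(Real.log 2 / 2 * t)) := by
  have h := tsum_vonMangoldt_mul_rpow_le ht
  set D := ∑' n : ℕ, ArithmeticFunction.vonMangoldt n * (n : ℝ) ^ (-(1 + t))
  have l2 : 0 < Real.log 2 := Real.log_pos (by norm_num)
  have hsinh := Real.self_le_sinh_iff.2 (show 0 ≤ Real.log 2 / 2 * t by positivity)
  rw [Real.sinh_eq] at hsinh
  have e : (2 : ℝ) ^ t = Real.exp (Real.log 2 / 2 * t) * Real.exp (Real.log 2 / 2 * t) := by
    rw [← Real.exp_add, Real.rpow_def_of_pos (by norm_num)]; ring_nf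
  rw [e] at h
  have h1 : 1 < Real.exp (Real.log 2 / 2 * t) := Real.one_lt_exp_iff.2 (by positivity)
  rw [Real.exp_neg] at hsinh ⊢
  set E := Real.exp (Real.log 2 / 2 * t)
  have hE : 0 < E * E - 1 := by nlinarith
  have hD : D ≤ Real.log 2 / (E * E - 1) := by rwa [le_div_iff₀ hE]
  have hy : t * Real.log 2 ≤ (E * E - 1) / E := by
    have : (E * E - 1) / E = E - E⁻¹ := by field_simp
    rw [this]; linarith
  calc t * D ≤ t * (Real.log 2 / (E * E - 1)) := by gcongr
    _ = t * Real.log 2 / (E * E - 1) := by ring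
    _ ≤ (E * E - 1) / E / (E * E - 1) := by gcongr
    _ = E⁻¹ := by rw [div_right_comm, div_self hE.ne', one_div]

open MeasureTheory Set in
lemma integral_mul_exp_neg_mul {r : ℝ} (hr : 0 < r) :
    ∫ t in Ioi (0 : ℝ), t * Real.exp (-(r * t)) = 1 / r ^ 2 := by
  have := Real.integral_rpow_mul_exp_neg_mul_Ioi (a := 2) (by norm_num) hr
  norm_num at this
  simpa using this

open MeasureTheory Set in
lemma integral_exp_neg_mul_Ioi {r : ℝ} (hr : 0 < r) :
    ∫ t in Ioi (0 : ℝ), Real.exp (-(r * t)) = 1 / r := by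
  have := Real.integral_rpow_mul_exp_neg_mul_Ioi (a := 1) (by norm_num) hr
  simpa using this

open MeasureTheory Set ArithmeticFunction in
lemma sum_vonMangoldt_div_log_sq_le {x : ℝ} (hx : 1 < x) (F : Finset ℕ) :
    ∑ q ∈ F, vonMangoldt q / (q * Real.log (x * q) ^ 2) ≤
      1 / (Real.log x + Real.log 2 / 2) := by
  have l2 : 0 < Real.log 2 := Real.log_pos (by norm_num)
  have lx : 0 < Real.log x := Real.log_pos hx
  have logpos : ∀ q : ℕ, q ≠ 0 → 0 < Real.log (x * q) := fun q hq ↦ by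
    have : (1 : ℝ) ≤ q := by exact_mod_cast Nat.one_le_iff_ne_zero.2 hq
    exact Real.log_pos (by nlinarith)
  have term : ∀ q : ℕ, vonMangoldt q / (q * Real.log (x * q) ^ 2) =
      ∫ t in Ioi (0 : ℝ), vonMangoldt q / q * (t * Real.exp (-(Real.log (x * q) * t))) := by
    intro q
    rcases eq_or_ne q 0 with rfl | hq
    · simp
    · rw [integral_const_mul, integral_mul_exp_neg_mul (logpos q hq)]
      field_simp
  have integ : ∀ q : ℕ, IntegrableOn
      (fun t ↦ vonMangoldt q / q * (t * Real.exp (-(Real.log (x * q) * t)))) (Ioi 0) := by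
    intro q
    rcases eq_or_ne q 0 with rfl | hq
    · simp
    · refine Integrable.const_mul (not_imp_comm.1 integral_undef ?_) _
      rw [integral_mul_exp_neg_mul (logpos q hq)]
      have := logpos q hq
      positivity
  have hr : 0 < Real.log x + Real.log 2 / 2 := by positivity
  rw [Finset.sum_congr rfl fun q _ ↦ term q, ← integral_finsetSum _ fun q _ ↦ integ q,
    ← integral_exp_neg_mul_Ioi hr]
  refine setIntegral_mono_on (integrable_finsetSum _ fun q _ ↦ integ q)
    (not_imp_comm.1 integral_undef ?_) measurableSet_Ioi fun t ht ↦ ?_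
  · rw [integral_exp_neg_mul_Ioi hr]
    positivity
  · have ht : 0 < t := ht
    have e : ∀ q ∈ F, vonMangoldt q / q * (t * Real.exp (-(Real.log (x * q) * t))) =
        Real.exp (-(Real.log x * t)) * (t * (vonMangoldt q * (q : ℝ) ^ (-(1 + t)))) := by
      intro q _
      rcases eq_or_ne q 0 with rfl | hq
      · simp
      · have hq0 : (0 : ℝ) < q := by exact_mod_cast Nat.pos_of_ne_zero hq
        rw [Real.log_mul (by linarith) hq0.ne', neg_add, Real.rpow_add hq0, Real.rpow_neg_one,
          Real.rpow_def_of_pos hq0, add_mul, neg_add, Real.exp_add]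
        ring_nf
    rw [Finset.sum_congr rfl e, ← Finset.mul_sum, ← Finset.mul_sum, add_mul,
      neg_add (Real.log x * t), Real.exp_add]
    refine mul_le_mul_of_nonneg_left (le_trans ?_ (mul_tsum_vonMangoldt_le ht))
      (Real.exp_pos _).le
    exact mul_le_mul_of_nonneg_left ((summable_vonMangoldt_mul_rpow (by linarith)).sum_le_tsum _
      fun q _ ↦ mul_nonneg vonMangoldt_nonneg (by positivity)) ht.le

open ArithmeticFunction in
lemma summable_one_div_mul_log_primes (Q : Set ℕ) (hQ : ∀ p ∈ Q, p.Prime) :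
    Summable fun p : Q ↦ 1 / (((p : ℕ) : ℝ) * Real.log ((p : ℕ) : ℝ)) := by
  refine summable_of_sum_le (c := 4 * (1 / (Real.log 2 + Real.log 2 / 2)))
    (fun p ↦ by positivity) fun u ↦ ?_
  refine le_trans ?_ (mul_le_mul_of_nonneg_left (sum_vonMangoldt_div_log_sq_le (x := 2)
    (by norm_num) (u.map (Function.Embedding.subtype _))) (by norm_num : (0 : ℝ) ≤ 4))
  rw [Finset.sum_map, Finset.mul_sum]
  refine Finset.sum_le_sum fun p _ ↦ ?_
  have hp := hQ p p.2
  have h2 : (2 : ℝ) ≤ (p : ℕ) := by exact_mod_cast hp.two_le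
  have l2 : 0 < Real.log 2 := Real.log_pos (by norm_num)
  have hlog : Real.log 2 ≤ Real.log (p : ℕ) := Real.log_le_log (by norm_num) h2
  simp only [Function.Embedding.subtype_apply]
  rw [vonMangoldt_apply_prime hp, Real.log_mul (by norm_num) (by linarith)]
  generalize Real.log (p : ℕ) = L at *
  have hL : 0 < L := by linarith
  rw [mul_div_assoc', div_le_div_iff₀ (by positivity) (by positivity)]
  have : (Real.log 2 + L) ^ 2 ≤ (2 * L) ^ 2 := by gcongr; linarith
  have hp0 : (0 : ℝ) ≤ (p : ℕ) := by linarith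
  nlinarith [mul_le_mul_of_nonneg_left this hp0]

open ArithmeticFunction in
lemma sum_vonMangoldt_proper_prime_powers_le {D P : Finset ℕ}
    (hP : ∀ p ∈ P, p.Prime)
    (hDP : ∀ m ∈ D, ¬ m.Prime → ∀ p, p.Prime → p ∣ m → p ∈ P) :
    ∑ m ∈ D with ¬ m.Prime, vonMangoldt m / (m * Real.log m ^ 2) ≤
      ∑ p ∈ P, 1 / (4 * p * (p - 1) * Real.log p) := by
  obtain ⟨K, hK⟩ : ∃ K, ∀ m ∈ D, m < K :=
    ⟨D.sup id + 1, fun m hm ↦ Nat.lt_succ_of_le (Finset.le_sup (f := id) hm)⟩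
  have step : ∀ m ∈ D.filter (fun m ↦ ¬ m.Prime), vonMangoldt m / (m * Real.log m ^ 2) ≤
      ∑ p ∈ P, ∑ k ∈ Finset.range K,
        if p ^ (k + 2) = m then 1 / (4 * (p : ℝ) ^ (k + 2) * Real.log p) else 0 := by
    intro m hm
    obtain ⟨hmD, hm⟩ := Finset.mem_filter.1 hm
    have nonneg : ∀ p ∈ P, ∀ k ∈ Finset.range K,
        (0 : ℝ) ≤ if p ^ (k + 2) = m then 1 / (4 * (p : ℝ) ^ (k + 2) * Real.log p) else 0 :=
      fun p _ k _ ↦ by split_ifs <;> positivity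
    by_cases hpp : IsPrimePow m
    · obtain ⟨p, k, hp, hk, rfl⟩ := (isPrimePow_nat_iff m).1 hpp
      have hk1 : k ≠ 1 := by rintro rfl; exact hm (by simpa using hp)
      obtain ⟨j, rfl⟩ : ∃ j, k = j + 2 := ⟨k - 2, by omega⟩
      have hpP : p ∈ P := hDP _ hmD hm p hp (dvd_pow_self p (by omega))
      have hj : j ∈ Finset.range K := Finset.mem_range.2 <|
        lt_trans (by have := Nat.lt_pow_self hp.one_lt (n := j + 2); omega) (hK _ hmD)
      refine le_trans ?_ (Finset.single_le_sum (fun p hp ↦ Finset.sum_nonneg (nonneg p hp)) hpP)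
      refine le_trans ?_ (Finset.single_le_sum (nonneg p hpP) hj)
      rw [if_pos rfl, vonMangoldt_apply_pow (by omega), vonMangoldt_apply_prime hp]
      have hp1 : (1 : ℝ) < p := by exact_mod_cast hp.one_lt
      have hL : 0 < Real.log p := Real.log_pos hp1
      push_cast
      rw [Real.log_pow, div_le_div_iff₀ (by positivity) (by positivity)]
      push_cast
      have hpk : (0 : ℝ) < (p : ℝ) ^ (j + 2) := by positivity
      generalize (p : ℝ) ^ (j + 2) = y at *
      have : (2 : ℝ) ^ 2 ≤ ((j : ℝ) + 2) ^ 2 := by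
        gcongr
        linarith [(Nat.cast_nonneg j : (0 : ℝ) ≤ j)]
      have h3 : 0 ≤ y * Real.log p ^ 2 := by positivity
      nlinarith [mul_le_mul_of_nonneg_left this h3]
    · rw [vonMangoldt_eq_zero_iff.2 hpp, zero_div]
      exact Finset.sum_nonneg fun p hp ↦ Finset.sum_nonneg (nonneg p hp)
  refine (Finset.sum_le_sum step).trans ?_
  rw [Finset.sum_comm]
  refine Finset.sum_le_sum fun p hp ↦ ?_
  have hp1 : (1 : ℝ) < p := by exact_mod_cast (hP p hp).one_lt
  have hL : 0 < Real.log p := Real.log_pos hp1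
  rw [Finset.sum_comm]
  calc _ ≤ ∑ k ∈ Finset.range K, 1 / (4 * (p : ℝ) ^ (k + 2) * Real.log p) := by
        refine Finset.sum_le_sum fun k _ ↦ ?_
        rw [Finset.sum_ite_eq]
        split_ifs
        · rfl
        · positivity
    _ = 1 / (4 * p ^ 2 * Real.log p) * ∑ k ∈ Finset.range K, (p : ℝ)⁻¹ ^ k := by
        rw [Finset.mul_sum]
        refine Finset.sum_congr rfl fun k _ ↦ ?_
        rw [inv_pow, pow_add]
        field_simp
    _ ≤ 1 / (4 * p ^ 2 * Real.log p) * (1 - (p : ℝ)⁻¹)⁻¹ := by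
        gcongr
        have hp' : (p : ℝ)⁻¹ < 1 := inv_lt_one_of_one_lt₀ hp1
        rw [← tsum_geometric_of_lt_one (by positivity) hp']
        exact (summable_geometric_of_lt_one (by positivity) hp').sum_le_tsum _
          fun _ _ ↦ by positivity
    _ = 1 / (4 * p * (p - 1) * Real.log p) := by
        have : (p : ℝ) - 1 ≠ 0 := by linarith
        have e : 1 - (p : ℝ)⁻¹ = (p - 1) / p := by field_simp
        rw [e, inv_div]
        field_simp

open ArithmeticFunction in
lemma sum_sum_properDivisors_vonMangoldt_le {D B : Finset ℕ} (hB : ∀ n ∈ B, 1 < n)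
    (hDB : ∀ m ∈ D, ∀ n, n ∣ m → 1 < n → n < m → n ∈ B) (hD : ∀ m ∈ D, 1 < m) :
    ∑ m ∈ D, (∑ q ∈ m.properDivisors, vonMangoldt q) / (m * Real.log m ^ 2) ≤
      ∑ n ∈ B, 1 / n * (1 / (Real.log n + Real.log 2 / 2)) := by
  obtain ⟨K, hK⟩ : ∃ K, ∀ m ∈ D, m < K :=
    ⟨D.sup id + 1, fun m hm ↦ Nat.lt_succ_of_le (Finset.le_sup (f := id) hm)⟩
  have step : ∀ m ∈ D, (∑ q ∈ m.properDivisors, vonMangoldt q) / (m * Real.log m ^ 2) ≤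
      ∑ n ∈ B, ∑ q ∈ Finset.range K,
        if n * q = m then vonMangoldt q / (m * Real.log m ^ 2) else 0 := by
    intro m hm
    have nonneg : ∀ q n : ℕ,
        (0 : ℝ) ≤ if n * q = m then vonMangoldt q / (m * Real.log m ^ 2) else 0 :=
      fun q n ↦ by
        have := vonMangoldt_nonneg (n := q)
        split_ifs <;> positivity
    rw [Finset.sum_comm, Finset.sum_div]
    have sub : m.properDivisors ⊆ Finset.range K := fun q hq ↦
      Finset.mem_range.2 ((Nat.mem_properDivisors.1 hq).2.trans (hK m hm))
    refine le_trans (Finset.sum_le_sum fun q hq ↦ ?_) (Finset.sum_le_sum_of_subset_of_nonneg sub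
      fun q _ _ ↦ Finset.sum_nonneg fun n _ ↦ nonneg q n)
    obtain ⟨⟨n, rfl⟩, hlt⟩ := Nat.mem_properDivisors.1 hq
    by_cases hq1 : q = 1
    · subst hq1
      rw [vonMangoldt_apply_one, zero_div]
      exact Finset.sum_nonneg fun n' _ ↦ by simp
    have hm1 := hD _ hm
    have hq0 : 1 < q := by
      rcases Nat.eq_zero_or_pos q with rfl | h
      · simp at hm1
      · omega
    have hnB : n ∈ B := hDB _ hm n (dvd_mul_left n q) (by
      by_contra h
      have : q * n ≤ q * 1 := Nat.mul_le_mul_left q (by omega)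
      omega) (by nlinarith)
    refine le_trans (le_of_eq ?_) (Finset.single_le_sum (fun n' _ ↦ nonneg q n') hnB)
    rw [if_pos (mul_comm n q)]
  refine (Finset.sum_le_sum step).trans ?_
  rw [Finset.sum_comm]
  refine Finset.sum_le_sum fun n hn ↦ ?_
  have hn1 : (1 : ℝ) < n := by exact_mod_cast hB n hn
  rw [Finset.sum_comm]
  refine le_trans ?_ (mul_le_mul_of_nonneg_left
    (sum_vonMangoldt_div_log_sq_le hn1 (Finset.range K)) (by positivity))
  rw [Finset.mul_sum]
  refine Finset.sum_le_sum fun q _ ↦ ?_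
  have := vonMangoldt_nonneg (n := q)
  have e : ∀ m ∈ D, (if n * q = m then vonMangoldt q / (m * Real.log m ^ 2) else 0) =
      if n * q = m then 1 / (n : ℝ) * (vonMangoldt q / (q * Real.log (n * q) ^ 2)) else 0 := by
    intro m _
    split_ifs with h
    · subst h
      push_cast
      rw [div_mul_div_comm, one_mul, mul_assoc]
    · rfl
  rw [Finset.sum_congr rfl e, Finset.sum_ite_eq]
  split_ifs
  · rfl
  · positivity

lemma Nat.Prime.log_add_half_log_two_le {p : ℕ} (hp : p.Prime) :
    Real.log p + Real.log 2 / 2 ≤ 2 * (p - 1) * Real.log 2 := by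
  have l2 : 0 < Real.log 2 := Real.log_pos (by norm_num)
  have h2 : (2 : ℝ) ≤ p := by exact_mod_cast hp.two_le
  have h : Real.log p ≤ (p - 1) * Real.log 2 := by
    have h1 : p ≤ 2 ^ (p - 1) := by
      have := Nat.lt_two_pow_self (n := p - 1)
      omega
    have h3 : (p : ℝ) ≤ 2 ^ (p - 1) := by exact_mod_cast h1
    have := Real.log_le_log (by linarith) h3
    rwa [Real.log_pow, Nat.cast_sub hp.one_le, Nat.cast_one] at this
  nlinarith

lemma Nat.Prime.outflow_le {p : ℕ} (hp : p.Prime) :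
    1 / (p : ℝ) * (1 / (Real.log p + Real.log 2 / 2)) + 1 / (4 * p * (p - 1) * Real.log p) ≤
      1 / (p * Real.log p) := by
  have l2 : 0 < Real.log 2 := Real.log_pos (by norm_num)
  have hp1 : (1 : ℝ) < p := by exact_mod_cast hp.one_lt
  have hL : 0 < Real.log p := Real.log_pos hp1
  have hp' : 0 < (p : ℝ) - 1 := by linarith
  have key := hp.log_add_half_log_two_le
  have e : 1 / (p * Real.log p) - (1 / (p : ℝ) * (1 / (Real.log p + Real.log 2 / 2)) +
      1 / (4 * p * (p - 1) * Real.log p)) =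
      (2 * (p - 1) * Real.log 2 - (Real.log p + Real.log 2 / 2)) /
        (4 * p * (p - 1) * Real.log p * (Real.log p + Real.log 2 / 2)) := by
    field_simp
    ring
  rw [← sub_nonneg, e]
  exact div_nonneg (by linarith) (by positivity)

open ArithmeticFunction in
lemma sum_not_prime_le_sum {D B : Finset ℕ} (hB : ∀ n ∈ B, 1 < n)
    (hDB : ∀ m ∈ D, ∀ n, n ∣ m → 1 < n → n < m → n ∈ B) (hD : ∀ m ∈ D, 1 < m) :
    ∑ m ∈ D with ¬ m.Prime, 1 / ((m : ℝ) * Real.log m) ≤ ∑ n ∈ B, 1 / ((n : ℝ) * Real.log n) := by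
  have e : ∀ m ∈ D.filter (fun m ↦ ¬ m.Prime), 1 / ((m : ℝ) * Real.log m) =
      (∑ q ∈ m.properDivisors, vonMangoldt q) / (m * Real.log m ^ 2) +
        vonMangoldt m / (m * Real.log m ^ 2) := by
    intro m hm
    have hm1 := hD m (Finset.mem_filter.1 hm).1
    have hL : 0 < Real.log m := Real.log_pos (by exact_mod_cast hm1)
    have hsum : ∑ q ∈ m.properDivisors, vonMangoldt q + vonMangoldt m = Real.log m := by
      rw [← vonMangoldt_sum, ← Nat.cons_self_properDivisors (by omega), Finset.sum_cons, add_comm]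
    rw [← add_div, hsum]
    field_simp
  rw [Finset.sum_congr rfl e, Finset.sum_add_distrib]
  have h1 := sum_sum_properDivisors_vonMangoldt_le (D := D.filter (fun m ↦ ¬ m.Prime)) hB
    (fun m hm ↦ hDB m (Finset.mem_filter.1 hm).1) (fun m hm ↦ hD m (Finset.mem_filter.1 hm).1)
  have h2 := sum_vonMangoldt_proper_prime_powers_le (D := D)
    (P := B.filter Nat.Prime) (fun p hp ↦ (Finset.mem_filter.1 hp).2)
    (fun m hm hmp p hp hpm ↦ Finset.mem_filter.2 ⟨hDB m hm p hpm hp.one_lt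
      (lt_of_le_of_ne (Nat.le_of_dvd (by linarith [hD m hm]) hpm)
        (by rintro rfl; exact hmp hp)), hp⟩)
  refine (add_le_add h1 h2).trans ?_
  rw [Finset.sum_filter, ← Finset.sum_add_distrib]
  refine Finset.sum_le_sum fun n hn ↦ ?_
  split_ifs with hp
  · exact hp.outflow_le
  · have l2 : 0 < Real.log 2 := Real.log_pos (by norm_num)
    have hn1 : (1 : ℝ) < n := by exact_mod_cast hB n hn
    have hL : 0 < Real.log n := Real.log_pos hn1
    rw [add_zero, one_div_mul_one_div]
    gcongr
    linarith

/-- For a finite primitive set `A` and its set `D` of divisors, the prime members of `D` carry at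
least the Erdos sum of `A`. -/
lemma Primitive.exists_primes_sum_le {A : Finset ℕ} (hA : Primitive (A : Set ℕ))
    (hA1 : ∀ a ∈ A, 1 < a) :
    ∃ P : Finset ℕ, (∀ p ∈ P, p.Prime ∧ ∃ a ∈ A, p ∣ a) ∧
      ∑ a ∈ A, 1 / ((a : ℝ) * Real.log a) ≤ ∑ p ∈ P, 1 / ((p : ℝ) * Real.log p) := by
  classical
  set D := (A.biUnion Nat.divisors).filter (1 < ·) with hD
  have memD : ∀ n, n ∈ D ↔ (∃ a ∈ A, n ∣ a) ∧ 1 < n := fun n ↦ by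
    simp only [hD, Finset.mem_filter, Finset.mem_biUnion, Nat.mem_divisors]
    exact and_congr_left fun _ ↦ exists_congr fun a ↦ and_congr_right fun ha ↦
      and_iff_left (by linarith [hA1 a ha])
  have hAD : A ⊆ D := fun a ha ↦ (memD a).2 ⟨⟨a, ha, dvd_rfl⟩, hA1 a ha⟩
  have main := sum_not_prime_le_sum (D := D) (B := D \ A)
    (fun n hn ↦ ((memD n).1 (Finset.mem_sdiff.1 hn).1).2)
    (fun m hm n hnm hn1 hlt ↦ by
      obtain ⟨⟨a, ha, hma⟩, hm1⟩ := (memD m).1 hm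
      refine Finset.mem_sdiff.2 ⟨(memD n).2 ⟨⟨a, ha, hnm.trans hma⟩, hn1⟩, fun hnA ↦ ?_⟩
      have := Nat.le_of_dvd (by linarith [hA1 a ha]) hma
      exact hA n hnA a ha (by omega) (hnm.trans hma))
    (fun m hm ↦ ((memD m).1 hm).2)
  refine ⟨D.filter Nat.Prime, fun p hp ↦ ?_, ?_⟩
  · obtain ⟨hp, hpp⟩ := Finset.mem_filter.1 hp
    exact ⟨hpp, ((memD p).1 hp).1⟩
  · have h1 := Finset.sum_filter_add_sum_filter_not D Nat.Prime
      fun n ↦ 1 / ((n : ℝ) * Real.log n)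
    have h2 := Finset.sum_sdiff (f := fun n : ℕ ↦ 1 / ((n : ℝ) * Real.log n)) hAD
    linarith

theorem primitive_restricted_bound (A : Set ℕ) (hA : Primitive A) (h1 : 1 ∉ A)
    (Q : Set ℕ) (hQ : ∀ p ∈ Q, p.Prime) :
    fSet (restrictPrimes A Q) ≤ fSet Q := by
  classical
  refine Real.tsum_le_of_sum_le (fun a ↦ by positivity) fun u ↦ ?_
  set U : Finset ℕ := u.map (Function.Embedding.subtype _) with hU
  have hUmem : ∀ a ∈ U, a ∈ restrictPrimes A Q := fun a ha ↦ by
    obtain ⟨b, -, rfl⟩ := Finset.mem_map.1 ha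
    exact b.2
  have sumU : ∑ a ∈ u, 1 / (((a : ℕ) : ℝ) * Real.log ((a : ℕ) : ℝ)) =
      ∑ a ∈ U.erase 0, 1 / ((a : ℝ) * Real.log a) := by
    rw [Finset.sum_erase _ (by simp), hU, Finset.sum_map]
    rfl
  obtain ⟨P, hP, hle⟩ := Primitive.exists_primes_sum_le (A := U.erase 0)
    (fun a ha b hb ↦ hA a (hUmem a (Finset.mem_of_mem_erase ha)).1 b
      (hUmem b (Finset.mem_of_mem_erase hb)).1)
    (fun a ha ↦ by
      have h0 := Finset.ne_of_mem_erase ha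
      have : a ≠ 1 := by rintro rfl; exact h1 (hUmem 1 (Finset.mem_of_mem_erase ha)).1
      omega)
  rw [sumU]
  refine hle.trans ?_
  have hPQ : ∀ p ∈ P, p ∈ Q := fun p hp ↦ by
    obtain ⟨hpp, a, ha, hpa⟩ := hP p hp
    exact (hUmem a (Finset.mem_of_mem_erase ha)).2 p hpp hpa
  rw [← Finset.sum_subtype_of_mem (p := (· ∈ Q)) (fun n : ℕ ↦ 1 / ((n : ℝ) * Real.log n)) hPQ]
  exact (summable_one_div_mul_log_primes Q hQ).sum_le_tsum _ fun p _ ↦ by positivity
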